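/- Let G be a finite simple graph. The induced tree polytope of G (the convex hull of the extended incidence vectors of the induced trees of G) is equal to the polytope T(G) if and only if G is chordal. -/

import Mathlib

open SimpleGraph Finset
open scoped Classical

/-- A graph has a hole if some set of vertices induces a cycle of length at least 4. -/
def SimpleGraph.HasHole {V : Type*} (G : SimpleGraph V) : Prop :=
  ∃ (W : Set V) (n : ℕ), 4 ≤ n ∧ Nonempty (G.induce W ≃g SimpleGraph.cycleGraph n)

/-- A graph is chordal if it has no hole. -/
def SimpleGraph.Chordal {V : Type*} (G : SimpleGraph V) : Prop := ¬ G.HasHole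

/-- `W` induces a tree in `G`. -/
def SimpleGraph.IsInducedTree {V : Type*} (G : SimpleGraph V) (W : Finset V) : Prop :=
  (G.induce (W : Set V)).IsTree

/-- `W` induces a path in `G`. -/
def SimpleGraph.IsInducedPath {V : Type*} (G : SimpleGraph V) (W : Finset V) : Prop :=
  ∃ n : ℕ, 1 ≤ n ∧ Nonempty (G.induce (W : Set V) ≃g SimpleGraph.pathGraph n)

/-- The extended incidence vector of a vertex set `W`. -/
noncomputable def SimpleGraph.xi {V : Type*} (G : SimpleGraph V) (W : Finset V) :
    (V → ℝ) × (Sym2 V → ℝ) :=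
  (fun v => if v ∈ W then 1 else 0,
   fun e => if e ∈ G.edgeSet ∧ ∀ v ∈ e, v ∈ W then 1 else 0)

/-- `K` is a maximal clique of `G`. -/
def SimpleGraph.IsMaxCliqueF {V : Type*} (G : SimpleGraph V) (K : Finset V) : Prop :=
  G.IsClique (K : Set V) ∧ ∀ K' : Finset V, G.IsClique (K' : Set V) → K ⊆ K' → K' = K

/-- The induced tree cone `C_T(G)`. -/
noncomputable def SimpleGraph.inducedTreeCone {V : Type*} (G : SimpleGraph V) :
    Set ((V → ℝ) × (Sym2 V → ℝ)) :=
  {p | (∀ v, 0 ≤ p.1 v) ∧ (∀ e, 0 ≤ p.2 e) ∧ (∀ e, e ∉ G.edgeSet → p.2 e = 0) ∧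
    ∀ (v : V) (K : Finset V), G.IsMaxCliqueF K → v ∈ K →
      ∑ u ∈ K.erase v, p.2 s(u, v) ≤ p.1 v}

/-- The set of vertices outside `S` complete to `S`. -/
noncomputable def SimpleGraph.completeTo {V : Type*} [Fintype V] (G : SimpleGraph V)
    (S : Finset V) : Finset V :=
  Finset.univ.filter fun v => v ∉ S ∧ ∀ u ∈ S, G.Adj v u

/-- The induced path cone `C_P(G)`. -/
noncomputable def SimpleGraph.inducedPathCone {V : Type*} [Fintype V] (G : SimpleGraph V) :
    Set ((V → ℝ) × (Sym2 V → ℝ)) :=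
  {p | (∀ v, 0 ≤ p.1 v) ∧ (∀ e, 0 ≤ p.2 e) ∧ (∀ e, e ∉ G.edgeSet → p.2 e = 0) ∧
    ∀ (w : V) (K : Finset V), (K : Set V) ⊆ G.neighborSet w → G.IsClique (K : Set V) →
      ∑ u ∈ G.completeTo (insert w K), p.2 s(w, u) + 2 * ∑ u ∈ K, p.2 s(w, u) ≤ 2 * p.1 w}

/-- The polytope `T(G)`: intersection of `C_T(G)` with the hyperplane `x(V) - y(E) = 1`. -/
noncomputable def SimpleGraph.treePolyT {V : Type*} [Fintype V] (G : SimpleGraph V) :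
    Set ((V → ℝ) × (Sym2 V → ℝ)) :=
  {p ∈ G.inducedTreeCone | ∑ v : V, p.1 v - ∑ e : Sym2 V, p.2 e = 1}

/-- The polytope `P(G)`: intersection of `C_P(G)` with the hyperplane `x(V) - y(E) = 1`. -/
noncomputable def SimpleGraph.pathPolyP {V : Type*} [Fintype V] (G : SimpleGraph V) :
    Set ((V → ℝ) × (Sym2 V → ℝ)) :=
  {p ∈ G.inducedPathCone | ∑ v : V, p.1 v - ∑ e : Sym2 V, p.2 e = 1}

/-- The induced tree polytope: convex hull of extended incidence vectors of induced trees. -/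
noncomputable def SimpleGraph.inducedTreePolytope {V : Type*} (G : SimpleGraph V) :
    Set ((V → ℝ) × (Sym2 V → ℝ)) :=
  convexHull ℝ {p | ∃ W : Finset V, G.IsInducedTree W ∧ p = G.xi W}

/-- The induced path polytope: convex hull of extended incidence vectors of induced paths. -/
noncomputable def SimpleGraph.inducedPathPolytope {V : Type*} (G : SimpleGraph V) :
    Set ((V → ℝ) × (Sym2 V → ℝ)) :=
  convexHull ℝ {p | ∃ W : Finset V, G.IsInducedPath W ∧ p = G.xi W}

/-- `p` is an extreme point of `s`: it cannot be written as the midpoint of two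
distinct points of `s`. -/
def IsExtremePt {E : Type*} [AddCommGroup E] [Module ℝ E] (s : Set E) (p : E) : Prop :=
  p ∈ s ∧ ∀ q r : E, q ∈ s → r ∈ s → p = (2⁻¹ : ℝ) • (q + r) → q = r

/-- `u` is an extremity of the induced path `W` (degree at most 1 in the induced subgraph). -/
noncomputable def SimpleGraph.IsExtremity {V : Type*} (G : SimpleGraph V) (u : V)
    (W : Finset V) : Prop :=
  u ∈ W ∧ (W.filter fun w => G.Adj u w).card ≤ 1

/-- The neighborhood of `v` as a `Finset`. -/
noncomputable def SimpleGraph.nbrF {V : Type*} [Fintype V] (G : SimpleGraph V) (v : V) :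
    Finset V :=
  Finset.univ.filter fun u => G.Adj v u

/-- `K` defines an orbit of `w`. -/
noncomputable def SimpleGraph.DefinesOrbit {V : Type*} [Fintype V] (G : SimpleGraph V)
    (w : V) (K : Finset V) : Prop :=
  (K : Set V) ⊆ G.neighborSet w ∧ G.IsClique (K : Set V) ∧
    ¬ ∃ K' : Finset V, (K' : Set V) ⊆ G.neighborSet w ∧ G.IsClique (K' : Set V) ∧ K ⊂ K' ∧
      insert w K ∪ G.completeTo (insert w K) ⊆ insert w K' ∪ G.completeTo (insert w K')

namespace SimpleGraph

variable {V : Type*} {G : SimpleGraph V}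

/-- A vertex `v` together with a path through non-neighbors of `v` that joins two nonadjacent
neighbors of `v` produces a hole. -/
theorem hasHole_of_reachable {v a b : V} {B : Set V} (hva : G.Adj v a) (hvb : G.Adj v b)
    (hab : a ≠ b) (hnab : ¬ G.Adj a b) (hB : ∀ x ∈ B, x ≠ v ∧ ¬ G.Adj v x)
    (hr : (((⊤ : G.Subgraph).induce (insert a (insert b B))).spanningCoe).Reachable a b) :
    G.HasHole := by
  set H := ((⊤ : G.Subgraph).induce (insert a (insert b B))).spanningCoe with hH
  have hadj : ∀ x y, H.Adj x y ↔ x ∈ insert a (insert b B) ∧ y ∈ insert a (insert b B) ∧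
      G.Adj x y := fun x y => by simp [hH]
  obtain ⟨p, hp⟩ := hr.exists_walk_length_eq_dist
  obtain ⟨m, hm⟩ : ∃ m, m = p.length := ⟨_, rfl⟩
  have short : ∀ i j, i ≤ j → j ≤ m → ∀ q : H.Walk (p.getVert i) (p.getVert j),
      j ≤ i + q.length := by
    intro i j hij hj q
    have h := dist_le (((p.take i).append q).append (p.drop j))
    rw [← hp, Walk.length_append, Walk.length_append, Walk.take_length, Walk.drop_length] at h
    omega
  have inj : ∀ i j, i < j → j ≤ m → p.getVert i ≠ p.getVert j := by
    intro i j hij hj he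
    have h := short i j hij.le hj (Walk.nil.copy rfl he)
    simp at h
    omega
  have h0 : p.getVert 0 = a := p.getVert_zero
  have hl : p.getVert m = b := by rw [hm]; exact p.getVert_length
  have hm2 : 2 ≤ m := by
    rw [hm, hp]
    exact hr.one_lt_dist_of_ne_of_not_adj hab (fun h => hnab ((hadj _ _).1 h).2.2)
  have memT : ∀ i, i ≤ m → p.getVert i ∈ insert a (insert b B) := by
    intro i hi
    rcases hi.lt_or_eq with h | rfl
    · exact ((hadj _ _).1 (p.adj_getVert_succ (hm ▸ h))).1
    · simp [hl]
  have hstep : ∀ i j, i < j → j ≤ m → (G.Adj (p.getVert i) (p.getVert j) ↔ j = i + 1) := by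
    intro i j hij hj
    constructor
    · intro h
      have h' : H.Adj (p.getVert i) (p.getVert j) :=
        (hadj _ _).2 ⟨memT _ (hij.le.trans hj), memT _ hj, h⟩
      have := short i j hij.le hj h'.toWalk
      simp at this
      omega
    · rintro rfl
      exact ((hadj _ _).1 (p.adj_getVert_succ (by omega))).2.2
  have hv : ∀ i, i ≤ m → (G.Adj v (p.getVert i) ↔ i = 0 ∨ i = m) := by
    intro i hi
    constructor
    · intro h
      by_contra! hc
      rcases memT i hi with h1 | h1 | h1
      · exact inj 0 i (by omega) hi (h0.trans h1.symm)
      · exact inj i m (by omega) le_rfl (h1.trans hl.symm)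
      · exact (hB _ h1).2 h
    · rintro (rfl | rfl)
      · rwa [h0]
      · rwa [hl]
  have hvne : ∀ i, i ≤ m → p.getVert i ≠ v := by
    intro i hi h
    rcases memT i hi with h1 | h1 | h1
    · exact hva.ne (h.symm.trans h1)
    · exact hvb.ne (h.symm.trans h1)
    · exact (hB _ h1).1 h
  let f : Fin (m + 2) → V := fun i => if i.1 ≤ m then p.getVert i else v
  have flt : ∀ i j : Fin (m + 2), i < j → f i ≠ f j ∧
      (G.Adj (f i) (f j) ↔ (cycleGraph (m + 2)).Adj i j) := by
    intro i j hij
    have hi := i.2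
    have hj := j.2
    have hij' : i.1 < j.1 := hij
    have hc : (cycleGraph (m + 2)).Adj i j ↔ j.1 = i.1 + 1 ∨ (i.1 = 0 ∧ j.1 = m + 1) := by
      rw [cycleGraph_adj']
      rw [Fin.sub_def, Fin.sub_def]
      dsimp only
      rw [Nat.mod_eq_of_lt (a := m + 2 - j.1 + i.1) (by omega)]
      rw [show m + 2 - i.1 + j.1 = (j.1 - i.1) + (m + 2) by omega, Nat.add_mod_right,
        Nat.mod_eq_of_lt (by omega)]
      omega
    rw [hc]
    by_cases hjm : j.1 ≤ m
    · have him : i.1 ≤ m := by omega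
      simp only [f, hjm, him, if_true]
      refine ⟨inj _ _ hij' hjm, ?_⟩
      rw [hstep _ _ hij' hjm]
      omega
    · have him : i.1 ≤ m := by omega
      simp only [f, hjm, him, if_true, if_false]
      refine ⟨hvne _ him, ?_⟩
      rw [adj_comm, hv _ him]
      omega
  have finj : Function.Injective f := by
    intro i j h
    rcases lt_trichotomy i j with hij | hij | hij
    · exact absurd h (flt _ _ hij).1
    · exact hij
    · exact absurd h.symm (flt _ _ hij).1
  refine ⟨Set.range f, m + 2, by omega, ⟨RelIso.symm ⟨Equiv.ofInjective f finj, ?_⟩⟩⟩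
  intro i j
  change G.Adj (f i) (f j) ↔ _
  rcases lt_trichotomy i j with hij | rfl | hij
  · exact (flt _ _ hij).2
  · simp
  · rw [adj_comm, (flt _ _ hij).2, adj_comm]

/-- In a chordal graph, any vertex of `A` with a non-neighbor in `A` has a non-neighbor in `A`
that is simplicial in the subgraph induced by `A`. -/
theorem Chordal.exists_simplicial_not_adj (hG : G.Chordal) (A : Finset V) :
    ∀ v ∈ A, (∃ c ∈ A, c ≠ v ∧ ¬ G.Adj v c) →
      ∃ s ∈ A, s ≠ v ∧ ¬ G.Adj v s ∧ G.IsClique {u | u ∈ A ∧ G.Adj s u} := by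
  induction A using Finset.strongInduction with
  | H A ih =>
  rintro v hvA ⟨c₀, hc₀A, hc₀v, hc₀⟩
  let B : Set V := {x | x ∈ A ∧ x ≠ v ∧ ¬ G.Adj v x}
  let H := ((⊤ : G.Subgraph).induce B).spanningCoe
  have hadj : ∀ x y, H.Adj x y ↔ x ∈ B ∧ y ∈ B ∧ G.Adj x y := fun x y => by simp [H]
  have hreachB : ∀ x, H.Reachable c₀ x → x ∈ B := by
    rintro x ⟨p⟩
    cases hx : p.reverse with
    | nil => exact ⟨hc₀A, hc₀v, hc₀⟩
    | cons h q => exact ((hadj _ _).1 h).1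
  let C : Finset V := A.filter fun x => H.Reachable c₀ x
  let S : Finset V := A.filter fun a => G.Adj v a ∧ ∃ c ∈ C, G.Adj a c
  have hC : ∀ x, x ∈ C ↔ H.Reachable c₀ x := fun x => by
    simp only [C, Finset.mem_filter, and_iff_right_iff_imp]
    exact fun h => (hreachB x h).1
  have hSclique : G.IsClique (S : Set V) := by
    intro a ha b hb hab
    by_contra hnab
    obtain ⟨haA, hva, c, hc, hac⟩ := Finset.mem_filter.1 (Finset.mem_coe.1 ha)
    obtain ⟨hbA, hvb, d, hd, hbd⟩ := Finset.mem_filter.1 (Finset.mem_coe.1 hb)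
    rw [hC] at hc hd
    refine hG (hasHole_of_reachable (B := B) hva hvb hab hnab (fun x hx => hx.2) ?_)
    have h1 : H.Reachable c d := hc.symm.trans hd
    have hcB := hreachB c hc
    have hdB := hreachB d hd
    refine (Adj.reachable ?_).trans ((h1.mono ?_).trans (Adj.reachable ?_))
    · simp [hac, hcB]
    · intro x y hxy
      obtain ⟨hx, hy, h⟩ := (hadj _ _).1 hxy
      simp [hx, hy, h]
    · simp [hbd.symm, hdB]
  have hnbr : ∀ c ∈ C, ∀ u ∈ A, G.Adj c u → u ∈ C ∪ S := by
    intro c hc u hu hcu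
    by_cases huB : u ∈ B
    · refine Finset.mem_union_left _ ((hC u).2 (((hC c).1 hc).trans (Adj.reachable ?_)))
      exact (hadj _ _).2 ⟨hreachB c ((hC c).1 hc), huB, hcu⟩
    · refine Finset.mem_union_right _ (Finset.mem_filter.2 ⟨hu, ?_, c, hc, hcu.symm⟩)
      by_contra hvu
      refine huB ⟨hu, ?_, hvu⟩
      rintro rfl
      exact (hreachB c ((hC c).1 hc)).2.2 hcu.symm
  have hCA : C ⊆ A := Finset.filter_subset _ _
  have hSA : S ⊆ A := Finset.filter_subset _ _
  have hvC : v ∉ C := fun h => (hreachB v ((hC v).1 h)).2.1 rfl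
  have hvS : v ∉ S := fun h => (Finset.mem_filter.1 h).2.1.ne rfl
  have hcC : c₀ ∈ C := (hC _).2 (Reachable.refl _)
  have hCS : C ∪ S ⊂ A := by
    refine (Finset.ssubset_iff_of_subset (Finset.union_subset hCA hSA)).2 ⟨v, hvA, ?_⟩
    simp [hvC, hvS]
  -- it suffices to find a vertex of `C` that is simplicial in `C ∪ S`
  suffices h : ∃ s ∈ C, G.IsClique {u | u ∈ C ∪ S ∧ G.Adj s u} by
    obtain ⟨s, hs, hcl⟩ := h
    have hsB := hreachB s ((hC s).1 hs)
    refine ⟨s, hCA hs, hsB.2.1, hsB.2.2, hcl.subset ?_⟩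
    rintro u ⟨hu, hsu⟩
    exact ⟨hnbr s hs u hu hsu, hsu⟩
  by_cases hw : ∃ w ∈ S, ∃ c ∈ C, ¬ G.Adj w c
  · obtain ⟨w, hwS, c, hc, hwc⟩ := hw
    have hne : ∀ x ∈ C, ∀ y ∈ S, x ≠ y := by
      rintro x hx y hy rfl
      exact (hreachB x ((hC x).1 hx)).2.2 (Finset.mem_filter.1 hy).2.1
    obtain ⟨s, hs, hsw, hws, hcl⟩ := ih _ hCS w (Finset.mem_union_right _ hwS)
      ⟨c, Finset.mem_union_left _ hc, hne c hc w hwS, hwc⟩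
    refine ⟨s, ?_, hcl⟩
    rcases Finset.mem_union.1 hs with h | h
    · exact h
    · exact absurd (hSclique hwS h hsw.symm) hws
  · push Not at hw
    have hCA' : C ⊂ A := (Finset.subset_union_left).trans_ssubset hCS
    obtain ⟨s, hs, hcl⟩ : ∃ s ∈ C, G.IsClique {u | u ∈ C ∧ G.Adj s u} := by
      by_cases hcC' : G.IsClique (C : Set V)
      · exact ⟨c₀, hcC, hcC'.subset fun u hu => hu.1⟩
      · simp only [IsClique, Set.Pairwise] at hcC'
        push Not at hcC'
        obtain ⟨x, hx, y, hy, hxy, hn⟩ := hcC'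
        obtain ⟨s, hs, -, -, h⟩ := ih C hCA' x hx ⟨y, hy, hxy.symm, hn⟩
        exact ⟨s, hs, h⟩
    refine ⟨s, hs, ?_⟩
    rintro x ⟨hx, hsx⟩ y ⟨hy, hsy⟩ hxy
    rcases Finset.mem_union.1 hx with hx | hx <;> rcases Finset.mem_union.1 hy with hy | hy
    · exact hcl ⟨hx, hsx⟩ ⟨hy, hsy⟩ hxy
    · exact (hw y hy x hx).symm
    · exact hw x hx y hy
    · exact hSclique hx hy hxy

/-- Dirac's theorem: every nonempty induced subgraph of a chordal graph has a simplicial vertex. -/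
theorem Chordal.exists_simplicial (hG : G.Chordal) {A : Finset V} (hA : A.Nonempty) :
    ∃ s ∈ A, G.IsClique {u | u ∈ A ∧ G.Adj s u} := by
  by_cases h : G.IsClique (A : Set V)
  · obtain ⟨s, hs⟩ := hA
    exact ⟨s, hs, h.subset fun u hu => hu.1⟩
  · simp only [IsClique, Set.Pairwise] at h
    push Not at h
    obtain ⟨x, hx, y, hy, hxy, hn⟩ := h
    obtain ⟨s, hs, -, -, h⟩ := hG.exists_simplicial_not_adj A x hx ⟨y, hy, hxy.symm, hn⟩
    exact ⟨s, hs, h⟩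

theorem xi_snd_mk (W : Finset V) (u v : V) :
    (G.xi W).2 s(u, v) = if G.Adj u v ∧ u ∈ W ∧ v ∈ W then 1 else 0 := by
  simp [xi]

theorem sum_xi_snd_clique (W : Finset V) {Q : Finset V} (hQ : G.IsClique (Q : Set V)) {u : V}
    (hu : u ∈ Q) : ∑ v ∈ Q.erase u, (G.xi W).2 s(v, u) =
      if u ∈ W then (((Q.erase u).filter (· ∈ W)).card : ℝ) else 0 := by
  split_ifs with h
  · rw [Finset.card_filter, Nat.cast_sum]
    refine Finset.sum_congr rfl fun v hv => ?_
    obtain ⟨hvu, hv⟩ := Finset.mem_erase.1 hv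
    simp [xi_snd_mk, h, hQ hv hu hvu]
  · exact Finset.sum_eq_zero fun v _ => by simp [xi_snd_mk, h]

theorem card_filter_clique_le_one {W : Finset V} (hW : (G.induce (W : Set V)).CliqueFree 3)
    {Q : Finset V} (hQ : G.IsClique (Q : Set V)) {u : V} (hu : u ∈ Q) (huW : u ∈ W) :
    ((Q.erase u).filter (· ∈ W)).card ≤ 1 := by
  refine Finset.card_le_one.2 fun a ha b hb => ?_
  by_contra hab
  simp only [Finset.mem_filter, Finset.mem_erase] at ha hb
  refine hW {⟨u, huW⟩, ⟨a, ha.2⟩, ⟨b, hb.2⟩} (is3Clique_triple_iff.2 ⟨?_, ?_, ?_⟩)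
  · exact hQ hu ha.1.2 ha.1.1.symm
  · exact hQ hu hb.1.2 hb.1.1.symm
  · exact hQ ha.1.2 hb.1.2 hab

theorem xi_mem_inducedTreeCone {W : Finset V} (hW : (G.induce (W : Set V)).CliqueFree 3) :
    G.xi W ∈ G.inducedTreeCone := by
  refine ⟨fun v => ?_, fun e => ?_, fun e he => ?_, fun v K hK hv => ?_⟩
  · simp only [xi]; split_ifs <;> norm_num
  · simp only [xi]; split_ifs <;> norm_num
  · simp [xi, he]
  · rw [sum_xi_snd_clique W hK.1 hv]
    simp only [xi]
    split_ifs with h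
    · exact_mod_cast card_filter_clique_le_one hW hK.1 hv h
    · exact le_rfl

theorem IsInducedTree.cliqueFree {W : Finset V} (hW : G.IsInducedTree W) :
    (G.induce (W : Set V)).CliqueFree 3 :=
  hW.isAcyclic.cliqueFree le_rfl

theorem isInducedTree_singleton (G : SimpleGraph V) (v : V) : G.IsInducedTree {v} := by
  have : Subsingleton (({v} : Finset V) : Set V) := by simp
  have : Nonempty (({v} : Finset V) : Set V) := ⟨⟨v, by simp⟩⟩
  exact IsTree.of_subsingleton

theorem xi_singleton (v : V) : G.xi {v} = (Pi.single v 1, 0) := by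
  refine Prod.ext (funext fun w => ?_) (funext fun e => ?_)
  · simp [xi, Pi.single_apply]
  · induction e with
    | h a b =>
    simp only [xi_snd_mk, Finset.mem_singleton, Pi.zero_apply, ite_eq_right_iff]
    rintro ⟨h, rfl, rfl⟩
    exact absurd rfl h.ne

section Fintype

variable [Fintype V]

theorem sum_xi_fst (W : Finset V) : ∑ v, (G.xi W).1 v = W.card := by
  simp [xi]

theorem sum_xi_snd (W : Finset V) :
    ∑ e, (G.xi W).2 e = Nat.card (G.induce (W : Set V)).edgeSet := by
  let F := (G.induce (W : Set V)).edgeFinset.map (Function.Embedding.subtype (· ∈ W)).sym2Map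
  have h : ∀ e, (G.xi W).2 e = if e ∈ F then 1 else 0 := by
    intro e
    induction e with
    | h a b =>
    rw [xi_snd_mk]
    refine if_congr ?_ rfl rfl
    simp only [F, Finset.mem_map, mem_edgeFinset]
    constructor
    · rintro ⟨hab, ha, hb⟩
      exact ⟨s(⟨a, ha⟩, ⟨b, hb⟩), hab, rfl⟩
    · rintro ⟨e, he, hab⟩
      induction e with
      | h x y =>
      have hxy : G.Adj x y := he
      rcases Sym2.eq_iff.1 (show s((x : V), (y : V)) = s(a, b) from hab) with
        ⟨rfl, rfl⟩ | ⟨rfl, rfl⟩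
      · exact ⟨hxy, x.2, y.2⟩
      · exact ⟨hxy.symm, y.2, x.2⟩
  rw [Finset.sum_congr rfl fun e _ => h e, Finset.sum_boole, Finset.filter_univ_mem,
    Finset.card_map, edgeFinset_card, ← Nat.card_eq_fintype_card]

theorem isInducedTree_iff (W : Finset V) :
    G.IsInducedTree W ↔ (G.induce (W : Set V)).Connected ∧
      ∑ v, (G.xi W).1 v - ∑ e, (G.xi W).2 e = 1 := by
  rw [IsInducedTree, isTree_iff_connected_and_card, sum_xi_fst, sum_xi_snd, sub_eq_iff_eq_add]
  simp only [SetLike.coe_sort_coe, Nat.card_eq_fintype_card, Fintype.card_coe]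
  refine and_congr_right fun _ => ?_
  rw [eq_comm, add_comm (1 : ℝ)]
  norm_cast

theorem convex_treePolyT : Convex ℝ G.treePolyT := by
  rintro p ⟨⟨hp1, hp2, hp3, hp4⟩, hp5⟩ q ⟨⟨hq1, hq2, hq3, hq4⟩, hq5⟩ a b ha hb hab
  refine ⟨⟨fun v => ?_, fun e => ?_, fun e he => ?_, fun v K hK hv => ?_⟩, ?_⟩
  · exact add_nonneg (mul_nonneg ha (hp1 v)) (mul_nonneg hb (hq1 v))
  · exact add_nonneg (mul_nonneg ha (hp2 e)) (mul_nonneg hb (hq2 e))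
  · simp [hp3 e he, hq3 e he]
  · simp only [Prod.fst_add, Prod.snd_add, Prod.smul_fst, Prod.smul_snd, Pi.add_apply,
      Pi.smul_apply, smul_eq_mul, Finset.sum_add_distrib, ← Finset.mul_sum]
    exact add_le_add (mul_le_mul_of_nonneg_left (hp4 v K hK hv) ha)
      (mul_le_mul_of_nonneg_left (hq4 v K hK hv) hb)
  · simp only [Prod.fst_add, Prod.snd_add, Prod.smul_fst, Prod.smul_snd, Pi.add_apply,
      Pi.smul_apply, smul_eq_mul, Finset.sum_add_distrib, ← Finset.mul_sum]
    linear_combination a * hp5 + b * hq5 + hab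

theorem inducedTreePolytope_subset_treePolyT : G.inducedTreePolytope ⊆ G.treePolyT := by
  refine convexHull_min ?_ convex_treePolyT
  rintro _ ⟨W, hW, rfl⟩
  exact ⟨xi_mem_inducedTreeCone hW.cliqueFree, ((isInducedTree_iff W).1 hW).2⟩

theorem cycleGraph_cliqueFree_three {n : ℕ} (hn : 4 ≤ n) : (cycleGraph n).CliqueFree 3 := by
  intro s hs
  obtain ⟨a, b, c, hab, hac, hbc, -⟩ := is3Clique_iff.1 hs
  simp only [cycleGraph_adj', Fin.sub_def] at hab hac hbc
  have key : ∀ x y : Fin n, (n - y.1 + x.1) % n =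
      if y.1 ≤ x.1 then x.1 - y.1 else n - y.1 + x.1 := by
    intro x y
    have := x.2
    have := y.2
    split_ifs with h
    · rw [show n - y.1 + x.1 = (x.1 - y.1) + n by omega, Nat.add_mod_right,
        Nat.mod_eq_of_lt (by omega)]
    · exact Nat.mod_eq_of_lt (by omega)
  simp only [key] at hab hac hbc
  split_ifs at hab hac hbc <;> omega

theorem card_edgeSet_cycleGraph {n : ℕ} (hn : 3 ≤ n) : Nat.card (cycleGraph n).edgeSet = n := by
  obtain ⟨k, rfl⟩ := Nat.exists_eq_add_of_le' hn
  have h := (cycleGraph (k + 3)).sum_degrees_eq_twice_card_edges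
  simp only [cycleGraph_degree_three_le, Finset.sum_const, Finset.card_univ, Fintype.card_fin,
    smul_eq_mul] at h
  rw [Nat.card_eq_fintype_card, ← edgeFinset_card]
  omega

/-- The incidence vector of a hole is a direction of recession of `T(G)`, so that `T(G)` is
unbounded as soon as `G` has a hole. -/
theorem exists_mem_treePolyT_not_mem_of_hasHole (hG : G.HasHole) :
    ∃ p ∈ G.treePolyT, p ∉ G.inducedTreePolytope := by
  obtain ⟨W', n, hn, ⟨φ⟩⟩ := hG
  obtain ⟨W, rfl⟩ : ∃ W : Finset V, (W : Set V) = W' := ⟨W'.toFinset, by simp⟩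
  obtain ⟨v, hv⟩ : W.Nonempty := ⟨_, (φ.symm ⟨0, by omega⟩).2⟩
  have hfree : (G.induce (W : Set V)).CliqueFree 3 :=
    (cycleGraph_cliqueFree_three hn).comap ⟨φ.toCopy⟩
  have hsum : ∑ v, (G.xi W).1 v - ∑ e, (G.xi W).2 e = 0 := by
    have h1 : Nat.card (W : Set V) = n := by
      rw [Nat.card_congr φ.toEquiv, Nat.card_eq_fintype_card, Fintype.card_fin]
    rw [sum_xi_fst, sum_xi_snd, Nat.card_congr φ.mapEdgeSet, card_edgeSet_cycleGraph (by omega)]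
    simp at h1
    simp [h1]
  have htree := G.isInducedTree_singleton v
  obtain ⟨hp1, hp2, hp3, hp4⟩ := xi_mem_inducedTreeCone htree.cliqueFree
  obtain ⟨hq1, hq2, hq3, hq4⟩ := xi_mem_inducedTreeCone hfree
  refine ⟨G.xi {v} + G.xi W, ⟨⟨fun v => ?_, fun e => ?_, fun e he => ?_, fun v K hK hv => ?_⟩, ?_⟩,
    fun hmem => ?_⟩
  · exact add_nonneg (hp1 v) (hq1 v)
  · exact add_nonneg (hp2 e) (hq2 e)
  · simp [hp3 e he, hq3 e he]
  · simp only [Prod.fst_add, Prod.snd_add, Pi.add_apply, Finset.sum_add_distrib]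
    exact add_le_add (hp4 v K hK hv) (hq4 v K hK hv)
  · simp only [Prod.fst_add, Prod.snd_add, Pi.add_apply, Finset.sum_add_distrib]
    linear_combination ((isInducedTree_iff _).1 htree).2 + hsum
  · have hle : G.inducedTreePolytope ⊆ {p | p.1 v ≤ 1} := by
      refine convexHull_min ?_ ?_
      · rintro _ ⟨W, -, rfl⟩
        simp only [xi, Set.mem_ofPred_eq]
        split_ifs <;> norm_num
      · exact convex_halfSpace_le (f := fun p : (V → ℝ) × (Sym2 V → ℝ) => p.1 v)
          ⟨fun _ _ => rfl, fun _ _ => rfl⟩ 1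
    have := hle hmem
    simp [xi, hv] at this
    norm_num at this

/-- Attaching a pendant vertex `s` to the vertex `u` of `W`. -/
theorem xi_insert {W : Finset V} {s u : V} (hs : s ∉ W) (huW : u ∈ W) (hsu : G.Adj s u)
    (huniq : ∀ v ∈ W, G.Adj s v → v = u) :
    G.xi (insert s W) = G.xi W + (Pi.single s 1, Pi.single s(s, u) 1) := by
  refine Prod.ext (funext fun v => ?_) (funext fun e => ?_)
  · by_cases hv : v = s
    · subst hv
      simp [xi, hs]
    · simp [xi, hv]
  · induction e with
    | h a b =>
    simp only [Prod.snd_add, Pi.add_apply, xi_snd_mk, Pi.single_apply, Sym2.eq_iff]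
    by_cases ha : a = s
    · subst ha
      by_cases hb : b = u
      · subst hb
        simp [hs, huW, hsu]
      · have : ¬ (G.Adj a b ∧ b ∈ W) := fun h => hb (huniq b h.2 h.1)
        by_cases hba : b = a
        · subst hba; simp [hs, hsu.ne]
        · simp [hs, hb, hba]; tauto
    · by_cases hb : b = s
      · subst hb
        by_cases hau : a = u
        · subst hau
          simp [hs, huW, hsu.symm]
        · have : ¬ (G.Adj b a ∧ a ∈ W) := fun h => hau (huniq a h.2 h.1)
          simp [hs, hau, ha]; tauto
      · simp [ha, hb]

theorem IsInducedTree.insert {W : Finset V} {s u : V} (hW : G.IsInducedTree W) (hs : s ∉ W)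
    (huW : u ∈ W) (hsu : G.Adj s u) (huniq : ∀ v ∈ W, G.Adj s v → v = u) :
    G.IsInducedTree (insert s W) := by
  rw [isInducedTree_iff] at hW ⊢
  refine ⟨?_, ?_⟩
  · rw [Finset.coe_insert, Set.insert_eq]
    have : Subsingleton ({s} : Set V) := by simp
    exact connected_induce_union (v := s) (w := u) Preconnected.of_subsingleton
      hW.1.preconnected rfl huW hsu
  · rw [xi_insert hs huW hsu huniq]
    simp only [Prod.fst_add, Prod.snd_add, Pi.add_apply, Finset.sum_add_distrib,
      Finset.sum_pi_single', Finset.mem_univ, if_true]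
    linear_combination hW.2

end Fintype

/-- The points of the induced tree cone supported on `A`, with one inequality for every clique. -/
def cliqueCone (G : SimpleGraph V) (A : Finset V) : Set ((V → ℝ) × (Sym2 V → ℝ)) :=
  {p | (∀ v, 0 ≤ p.1 v) ∧ (∀ e, 0 ≤ p.2 e) ∧ (∀ v, v ∉ A → p.1 v = 0) ∧
    (∀ e, e ∉ G.edgeSet → p.2 e = 0) ∧
    ∀ Q : Finset V, G.IsClique (Q : Set V) → ∀ v ∈ Q, ∑ u ∈ Q.erase v, p.2 s(u, v) ≤ p.1 v}

/-- The cone generated by the incidence vectors of the induced trees contained in `A`. -/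
noncomputable def treeSpan (G : SimpleGraph V) (A : Finset V) :
    Submodule NNReal ((V → ℝ) × (Sym2 V → ℝ)) :=
  Submodule.span NNReal {q | ∃ W : Finset V, W ⊆ A ∧ G.IsInducedTree W ∧ q = G.xi W}

theorem xi_mem_treeSpan {A W : Finset V} (hWA : W ⊆ A) (hW : G.IsInducedTree W) :
    G.xi W ∈ G.treeSpan A :=
  Submodule.subset_span ⟨W, hWA, hW, rfl⟩

theorem smul_mem_treeSpan {A : Finset V} {c : ℝ} (hc : 0 ≤ c) {q : (V → ℝ) × (Sym2 V → ℝ)}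
    (hq : q ∈ G.treeSpan A) : c • q ∈ G.treeSpan A :=
  (G.treeSpan A).smul_mem (⟨c, hc⟩ : NNReal) hq

theorem exists_of_mem_treeSpan {A : Finset V} {q : (V → ℝ) × (Sym2 V → ℝ)}
    (hq : q ∈ G.treeSpan A) : ∃ (n : ℕ) (w : Fin n → ℝ) (W : Fin n → Finset V),
      (∀ i, 0 ≤ w i) ∧ (∀ i, W i ⊆ A) ∧ (∀ i, G.IsInducedTree (W i)) ∧
      q = ∑ i, w i • G.xi (W i) := by
  obtain ⟨n, f, g, h⟩ := Submodule.mem_span_set'.1 hq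
  choose W hWA hW hg using fun i => (g i).2
  refine ⟨n, fun i => f i, W, fun i => (f i).2, hWA, hW, ?_⟩
  rw [← h]
  exact Finset.sum_congr rfl fun i _ => by rw [hg i]; rfl

theorem erase_mem_cliqueCone {A : Finset V} {p : (V → ℝ) × (Sym2 V → ℝ)}
    (hp : p ∈ G.cliqueCone A) (s : V) :
    ((fun v => if v = s then 0 else p.1 v), (fun e => if s ∈ e then 0 else p.2 e)) ∈
      G.cliqueCone (A.erase s) := by
  obtain ⟨h1, h2, h3, h4, h5⟩ := hp
  refine ⟨fun v => ?_, fun e => ?_, fun v hv => ?_, fun e he => ?_, fun Q hQ v hv => ?_⟩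
  · dsimp only; split_ifs <;> simp [h1]
  · dsimp only; split_ifs <;> simp [h2]
  · by_cases hvs : v = s
    · simp [hvs]
    · simp only [hvs, if_false]
      exact h3 v fun h => hv (Finset.mem_erase.2 ⟨hvs, h⟩)
  · simp [h4 e he]
  · by_cases hvs : v = s
    · simp [hvs]
    · simp only [hvs, if_false]
      refine le_trans (Finset.sum_le_sum fun u _ => ?_) (h5 Q hQ v hv)
      split_ifs
      · exact h2 _
      · exact le_rfl

/-- For a clique `Q`, the trees meeting `Q` exactly in `u` carry the slack of the inequality
of `Q` at `u`. -/
theorem sum_inter_eq_singleton {ι : Type*} [Fintype ι] {w : ι → ℝ} {W : ι → Finset V}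
    (hW : ∀ i, G.IsInducedTree (W i)) {Q : Finset V} (hQ : G.IsClique (Q : Set V)) {u : V}
    (hu : u ∈ Q) :
    ∑ i, w i * (if W i ∩ Q = {u} then 1 else 0) =
      (∑ i, w i • G.xi (W i)).1 u - ∑ v ∈ Q.erase u, (∑ i, w i • G.xi (W i)).2 s(v, u) := by
  simp only [Prod.fst_sum, Prod.snd_sum, Finset.sum_apply, Prod.smul_fst, Prod.smul_snd,
    Pi.smul_apply, smul_eq_mul]
  rw [Finset.sum_comm, ← Finset.sum_sub_distrib]
  refine Finset.sum_congr rfl fun i _ => ?_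
  rw [← Finset.mul_sum, ← mul_sub, sum_xi_snd_clique _ hQ hu]
  congr 1
  by_cases huW : u ∈ W i
  · have hc := card_filter_clique_le_one (hW i).cliqueFree hQ hu huW
    have hiff : W i ∩ Q = {u} ↔ ((Q.erase u).filter (· ∈ W i)).card = 0 := by
      rw [Finset.card_eq_zero, Finset.filter_eq_empty_iff, Finset.eq_singleton_iff_unique_mem]
      simp only [Finset.mem_inter, Finset.mem_erase]
      grind
    rw [if_pos huW]
    simp only [xi, if_pos huW, hiff]
    interval_cases ((Q.erase u).filter (· ∈ W i)).card <;> simp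
  · have : W i ∩ Q ≠ {u} := fun h => huW (Finset.mem_inter.1 (h ▸ Finset.mem_singleton_self u)).1
    simp [xi, huW, this]

variable [Fintype V]

/-- Extending by a simplicial vertex `s`: the trees avoiding `s` are extended by pendant edges
at `s`. -/
theorem mem_treeSpan_of_simplicial {A : Finset V} {s : V} (hsA : s ∈ A)
    (hs : G.IsClique {u | u ∈ A ∧ G.Adj s u}) {p : (V → ℝ) × (Sym2 V → ℝ)}
    (hp : p ∈ G.cliqueCone A)
    (ih : ∀ q ∈ G.cliqueCone (A.erase s), q ∈ G.treeSpan (A.erase s)) : p ∈ G.treeSpan A := by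
  obtain ⟨n, w, W, hw, hWA, hW, hsum⟩ := exists_of_mem_treeSpan (ih _ (erase_mem_cliqueCone hp s))
  obtain ⟨h1, h2, h3, h4, h5⟩ := hp
  set p' : (V → ℝ) × (Sym2 V → ℝ) :=
    ((fun v => if v = s then 0 else p.1 v), (fun e => if s ∈ e then 0 else p.2 e)) with hp'
  have hsW : ∀ i, s ∉ W i := fun i h => Finset.notMem_erase s A (hWA i h)
  let Q : Finset V := A.filter (G.Adj s)
  have memQ : ∀ u, u ∈ Q ↔ u ∈ A ∧ G.Adj s u := fun u => Finset.mem_filter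
  have hQ : G.IsClique (Q : Set V) := hs.subset fun u hu => (memQ u).1 hu
  have hsQ : s ∉ Q := fun h => ((memQ s).1 h).2.ne rfl
  have hsQc : G.IsClique ((insert s Q : Finset V) : Set V) := by
    rw [Finset.coe_insert, isClique_insert]
    exact ⟨hQ, fun u hu _ => ((memQ u).1 hu).2⟩
  let a : V → ℝ := fun u => ∑ i, w i * (if W i ∩ Q = {u} then 1 else 0)
  have ha : ∀ u ∈ Q, p.2 s(s, u) ≤ a u := by
    intro u hu
    have hus : u ≠ s := fun h => hsQ (h ▸ hu)
    have h := h5 _ hsQc u (Finset.mem_insert_of_mem hu)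
    rw [Finset.erase_insert_of_ne hus.symm,
      Finset.sum_insert (fun h => hsQ (Finset.mem_of_mem_erase h))] at h
    have h' : ∑ v ∈ Q.erase u, p'.2 s(v, u) = ∑ v ∈ Q.erase u, p.2 s(v, u) := by
      refine Finset.sum_congr rfl fun v hv => ?_
      have hvs : v ≠ s := fun h => hsQ (h ▸ Finset.mem_of_mem_erase hv)
      simp [hp', hvs.symm, hus.symm]
    have hu' : p'.1 u = p.1 u := by simp [hp', hus]
    simp only [a, sum_inter_eq_singleton hW hQ hu]
    rw [← hsum, h', hu']
    linarith
  let t : V → ℝ := fun u => p.2 s(s, u) / a u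
  have ht0 : ∀ u ∈ Q, 0 ≤ t u := fun u hu => div_nonneg (h2 _) ((h2 _).trans (ha u hu))
  have ht1 : ∀ u ∈ Q, t u ≤ 1 := fun u hu => div_le_one_of_le₀ (ha u hu) ((h2 _).trans (ha u hu))
  have hta : ∀ u ∈ Q, a u * t u = p.2 s(s, u) := by
    intro u hu
    by_cases h0 : a u = 0
    · have := ha u hu
      rw [h0, zero_mul]
      exact le_antisymm (h2 _) (h0 ▸ this)
    · exact mul_div_cancel₀ _ h0
  let b : V → (V → ℝ) × (Sym2 V → ℝ) := fun u => (Pi.single s 1, Pi.single s(s, u) 1)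
  have hext : ∀ i, G.xi (W i) + ∑ u ∈ Q, (if W i ∩ Q = {u} then t u else 0) • b u ∈
      G.treeSpan A := by
    intro i
    have hWA' : W i ⊆ A := (hWA i).trans (Finset.erase_subset _ _)
    by_cases h : ∃ u ∈ Q, W i ∩ Q = {u}
    · obtain ⟨u, hu, hWu⟩ := h
      have huW : u ∈ W i := (Finset.mem_inter.1 (hWu ▸ Finset.mem_singleton_self u)).1
      have hsu := ((memQ u).1 hu).2
      have huniq : ∀ v ∈ W i, G.Adj s v → v = u := fun v hv hsv =>
        Finset.mem_singleton.1 (hWu ▸ Finset.mem_inter.2 ⟨hv, (memQ v).2 ⟨hWA' hv, hsv⟩⟩)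
      have hsumQ : ∑ v ∈ Q, (if W i ∩ Q = {v} then t v else 0) • b v = t u • b u := by
        rw [Finset.sum_eq_single_of_mem u hu, if_pos hWu]
        intro v _ hvu
        rw [if_neg, zero_smul]
        rw [hWu, Finset.singleton_inj]
        exact hvu.symm
      have heq : G.xi (W i) + t u • b u =
          (1 - t u) • G.xi (W i) + t u • G.xi (insert s (W i)) := by
        rw [xi_insert (hsW i) huW hsu huniq]
        module
      rw [hsumQ, heq]
      exact add_mem
        (smul_mem_treeSpan (sub_nonneg.2 (ht1 u hu)) (xi_mem_treeSpan hWA' (hW i)))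
        (smul_mem_treeSpan (ht0 u hu) (xi_mem_treeSpan (Finset.insert_subset hsA hWA')
          ((hW i).insert (hsW i) huW hsu huniq)))
    · push Not at h
      rw [Finset.sum_eq_zero fun u hu => by rw [if_neg (h u hu), zero_smul], add_zero]
      exact xi_mem_treeSpan hWA' (hW i)
  have hrem : 0 ≤ p.1 s - ∑ u ∈ Q, p.2 s(s, u) := by
    have h := h5 _ hsQc s (Finset.mem_insert_self _ _)
    rw [Finset.erase_insert hsQ] at h
    simp only [Sym2.eq_swap (b := s)] at h
    linarith
  have hpsum : p = ∑ i, w i • (G.xi (W i) + ∑ u ∈ Q, (if W i ∩ Q = {u} then t u else 0) • b u) +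
      (p.1 s - ∑ u ∈ Q, p.2 s(s, u)) • G.xi {s} := by
    have hb : ∑ i, w i • ∑ u ∈ Q, (if W i ∩ Q = {u} then t u else 0) • b u =
        ∑ u ∈ Q, p.2 s(s, u) • b u := by
      simp only [Finset.smul_sum]
      rw [Finset.sum_comm]
      refine Finset.sum_congr rfl fun u hu => ?_
      rw [← hta u hu, Finset.sum_mul, Finset.sum_smul]
      exact Finset.sum_congr rfl fun i _ => by split_ifs <;> simp [smul_smul]
    simp only [smul_add, Finset.sum_add_distrib]
    rw [hb, ← hsum, xi_singleton]
    refine Prod.ext (funext fun v => ?_) (funext fun e => ?_)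
    · by_cases hv : v = s
      · subst hv
        simp [hp', b, Prod.fst_sum]
      · simp [hp', b, Prod.fst_sum, hv]
    · by_cases he : s ∈ e
      · obtain ⟨v, rfl⟩ := he
        have hz : v ∉ Q → p.2 s(s, v) = 0 := by
          intro hv
          by_cases hadj : G.Adj s v
          · have hvA : v ∉ A := fun h => hv ((memQ v).2 ⟨h, hadj⟩)
            have hcl : G.IsClique (({s, v} : Finset V) : Set V) := by
              simp [isClique_insert, hadj]
            have h := h5 _ hcl v (by simp)
            rw [h3 v hvA, Finset.pair_comm, Finset.erase_insert (by simp [hadj.ne']),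
              Finset.sum_singleton] at h
            exact le_antisymm h (h2 _)
          · exact h4 _ hadj
        have hone : ∀ u ∈ Q, (p.2 s(s, u) • b u).2 s(s, v) = if v = u then p.2 s(s, u) else 0 := by
          intro u hu
          have hus : s ≠ u := fun h => hsQ (h ▸ hu)
          simp [b, Pi.single_apply, hus]
        simp only [Prod.snd_add, Prod.snd_sum, Pi.add_apply, Finset.sum_apply]
        rw [Finset.sum_congr rfl hone, Finset.sum_ite_eq]
        by_cases hv : v ∈ Q
        · simp [hp', hv]
        · simp [hp', hv, hz hv]
      · have hne : ∀ u, e ≠ s(s, u) := by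
          rintro u rfl
          simp at he
        simp [hp', b, Prod.snd_sum, he, hne]
  rw [hpsum]
  exact add_mem (sum_mem fun i _ => smul_mem_treeSpan (hw i) (hext i))
    (smul_mem_treeSpan hrem (xi_mem_treeSpan (by simpa using hsA) (isInducedTree_singleton G s)))

theorem Chordal.cliqueCone_subset_treeSpan (hG : G.Chordal) (A : Finset V) :
    ∀ p ∈ G.cliqueCone A, p ∈ G.treeSpan A := by
  induction A using Finset.strongInduction with
  | H A ih =>
  intro p hp
  rcases A.eq_empty_or_nonempty with rfl | hA
  · obtain ⟨h1, h2, h3, h4, h5⟩ := hp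
    have : p = 0 := by
      refine Prod.ext (funext fun v => h3 v (by simp)) (funext fun e => ?_)
      induction e with
      | h a b =>
      by_cases hadj : G.Adj a b
      · have hcl : G.IsClique (({b, a} : Finset V) : Set V) := by
          simp [isClique_insert, hadj.symm]
        have h := h5 _ hcl b (by simp)
        rw [h3 b (by simp), Finset.erase_insert (by simp [hadj.ne']), Finset.sum_singleton] at h
        exact le_antisymm h (h2 _)
      · exact h4 _ hadj
    rw [this]
    exact zero_mem _
  · obtain ⟨s, hsA, hs⟩ := hG.exists_simplicial hA
    exact mem_treeSpan_of_simplicial hsA hs hp (ih _ (Finset.erase_ssubset hsA))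

theorem inducedTreeCone_subset_cliqueCone : G.inducedTreeCone ⊆ G.cliqueCone Finset.univ := by
  rintro p ⟨h1, h2, h3, h4⟩
  refine ⟨h1, h2, fun v hv => absurd (Finset.mem_univ v) hv, h3, fun Q hQ v hv => ?_⟩
  obtain ⟨K, hQK, hK⟩ := Finite.exists_le_maximal
    (p := fun K : Finset V => G.IsClique (K : Set V)) hQ
  refine le_trans (Finset.sum_le_sum_of_subset_of_nonneg (Finset.erase_subset_erase v hQK)
    fun u _ _ => h2 _) (h4 v K ⟨hK.1, fun K' hK' hle => ?_⟩ (hQK hv))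
  exact (hK.2 hK' hle).antisymm hle

theorem Chordal.treePolyT_subset_inducedTreePolytope (hG : G.Chordal) :
    G.treePolyT ⊆ G.inducedTreePolytope := by
  rintro p ⟨hp, hp1⟩
  obtain ⟨n, w, W, hw, -, hW, rfl⟩ := exists_of_mem_treeSpan
    (hG.cliqueCone_subset_treeSpan _ _ (inducedTreeCone_subset_cliqueCone hp))
  refine mem_convexHull_of_exists_fintype w (fun i => G.xi (W i)) hw ?_
    (fun i => ⟨W i, hW i, rfl⟩) rfl
  rw [← hp1]
  simp only [Prod.fst_sum, Prod.snd_sum, Finset.sum_apply, Prod.smul_fst, Prod.smul_snd,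
    Pi.smul_apply, smul_eq_mul]
  rw [Finset.sum_comm, Finset.sum_comm (s := Finset.univ (α := Sym2 V)),
    ← Finset.sum_sub_distrib]
  refine Finset.sum_congr rfl fun i _ => ?_
  rw [← Finset.mul_sum, ← Finset.mul_sum, ← mul_sub, ((isInducedTree_iff _).1 (hW i)).2, mul_one]

end SimpleGraph

/-- the induced tree polytope equals `T(G)` iff `G` is chordal. -/
theorem inducedTreePolytope_eq_iff_chordal {V : Type*} [Fintype V] (G : SimpleGraph V) :
    G.inducedTreePolytope = G.treePolyT ↔ G.Chordal := by
  refine ⟨fun h hG => ?_, fun hG => ?_⟩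
  · obtain ⟨p, hp, hp'⟩ := exists_mem_treePolyT_not_mem_of_hasHole hG
    exact hp' (h ▸ hp)
  · exact inducedTreePolytope_subset_treePolyT.antisymm hG.treePolyT_subset_inducedTreePolytope
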